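/- Let M ≥ 1 be an integer, let x_0,…,x_{M−1} be real numbers with |x_i| ≤ 1 for all i, let c > 0, let 0 < ε ≤ 1, and let p : ℝ → ℝ satisfy |p(y) − exp(−c·y²/2)| ≤ η for all y ∈ [−1,1], where 0 < η ≤ ε·exp(−c)/9. Then ∑_i | p(x_i)²/(∑_j p(x_j)²) − exp(−c·x_i²)/(∑_j exp(−c·x_j²)) | ≤ ε. -/

import Mathlib

/-- Normalizing two nonnegative weights at relative distance at most `δ` yields distributions at
ℓ¹ distance at most `2 * δ`. -/
theorem sum_abs_div_sum_sub_div_sum_le {ι : Type*} [Fintype ι] {a b : ι → ℝ} {δ : ℝ}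
    (ha : ∀ i, 0 ≤ a i) (hA : 0 < ∑ j, a j) (hB : 0 < ∑ j, b j)
    (hab : ∀ i, |a i - b i| ≤ δ * b i) :
    ∑ i, |a i / (∑ j, a j) - b i / (∑ j, b j)| ≤ 2 * δ := by
  have hAB : |∑ j, b j - ∑ j, a j| ≤ δ * ∑ j, b j := by
    rw [abs_sub_comm, ← Finset.sum_sub_distrib, Finset.mul_sum]
    exact (Finset.abs_sum_le_sum_abs _ _).trans (Finset.sum_le_sum fun i _ => hab i)
  set A := ∑ j, a j with hAdef
  set B := ∑ j, b j with hBdef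
  have hterm (i : ι) : |a i / A - b i / B| ≤ δ * b i / B + a i / A * δ := by
    have hsplit : a i / A - b i / B = (a i - b i) / B + a i / A * ((B - A) / B) := by
      field_simp
      ring
    rw [hsplit]
    refine (abs_add_le _ _).trans (add_le_add ?_ ?_)
    · rw [abs_div, abs_of_pos hB]
      exact div_le_div_of_nonneg_right (hab i) hB.le
    · have hnonneg : 0 ≤ a i / A := div_nonneg (ha i) hA.le
      rw [abs_mul, abs_of_nonneg hnonneg, abs_div, abs_of_pos hB]
      exact mul_le_mul_of_nonneg_left ((div_le_iff₀ hB).2 hAB) hnonneg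
  refine (Finset.sum_le_sum fun i _ => hterm i).trans (le_of_eq ?_)
  rw [Finset.sum_add_distrib, ← Finset.sum_div, ← Finset.mul_sum, ← Finset.sum_mul,
    ← Finset.sum_div, ← hAdef, ← hBdef]
  field_simp
  ring

/-- An additive error `η ≤ ε * g / 9` on `g` is a relative error at most `ε / 4` on `g ^ 2`. -/
theorem abs_sq_sub_sq_le_of_abs_sub_le {q g η ε : ℝ} (hε : 0 < ε) (hε1 : ε ≤ 1) (hg : 0 < g)
    (hη : η ≤ ε * g / 9) (hq : |q - g| ≤ η) : |q ^ 2 - g ^ 2| ≤ ε / 4 * g ^ 2 := by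
  have hdiff : |q - g| ≤ ε * g / 9 := hq.trans hη
  have hsum : |q + g| ≤ 19 / 9 * g := by
    have hεg : ε * g ≤ g := mul_le_of_le_one_left hg.le hε1
    obtain ⟨h₁, h₂⟩ := abs_le.1 hdiff
    exact abs_le.2 ⟨by linarith, by linarith⟩
  calc |q ^ 2 - g ^ 2| = |q - g| * |q + g| := by rw [← abs_mul]; ring_nf
    _ ≤ ε * g / 9 * (19 / 9 * g) := mul_le_mul hdiff hsum (abs_nonneg _) (by positivity)
    _ ≤ ε / 4 * g ^ 2 := by nlinarith [mul_pos hε (pow_pos hg 2)]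

/-- ℓ¹ comparison of the normalized polynomial-filtered and Gaussian eigenvalue
distributions: choosing `η ≤ ε·e^{−c}/9` guarantees ℓ¹ distance at most `ε`. -/
theorem poly_gaussian_l1_eps (M : ℕ) (hM : 1 ≤ M) (x : Fin M → ℝ) (hx : ∀ i, |x i| ≤ 1)
    (c : ℝ) (hc : 0 < c) (ε : ℝ) (hε : 0 < ε) (hε1 : ε ≤ 1)
    (p : ℝ → ℝ) (η : ℝ) (hη : 0 < η) (hηε : η ≤ ε * Real.exp (-c) / 9)
    (hp : ∀ y ∈ Set.Icc (-1 : ℝ) 1, |p y - Real.exp (-c * y ^ 2 / 2)| ≤ η) :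
    ∑ i : Fin M,
        |p (x i) ^ 2 / (∑ j : Fin M, p (x j) ^ 2) -
          Real.exp (-c * x i ^ 2) / (∑ j : Fin M, Real.exp (-c * x j ^ 2))| ≤ ε := by
  have : Nonempty (Fin M) := ⟨⟨0, hM⟩⟩
  have hrel (i : Fin M) :
      |p (x i) ^ 2 - Real.exp (-c * x i ^ 2)| ≤ ε / 4 * Real.exp (-c * x i ^ 2) := by
    have hsq : Real.exp (-c * x i ^ 2) = Real.exp (-c * x i ^ 2 / 2) ^ 2 := by
      rw [← Real.exp_nat_mul]
      congr 1
      push_cast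
      ring
    have hle : Real.exp (-c) ≤ Real.exp (-c * x i ^ 2 / 2) := by
      have hx2 : x i ^ 2 ≤ 1 := (sq_le_one_iff_abs_le_one _).2 (hx i)
      exact Real.exp_le_exp.2 (by nlinarith)
    rw [hsq]
    refine abs_sq_sub_sq_le_of_abs_sub_le hε hε1 (Real.exp_pos _) (hηε.trans ?_)
      (hp (x i) (abs_le.1 (hx i)))
    gcongr
  have hpos (i : Fin M) : 0 < p (x i) ^ 2 := by
    have hexp := Real.exp_pos (-c * x i ^ 2)
    nlinarith [(abs_le.1 (hrel i)).1]
  have hmain := sum_abs_div_sum_sub_div_sum_le (fun i => (hpos i).le)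
    (Finset.sum_pos (fun i _ => hpos i) Finset.univ_nonempty)
    (Finset.sum_pos (fun i _ => Real.exp_pos (-c * x i ^ 2)) Finset.univ_nonempty) hrel
  linarith
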